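/- Let k be a field of characteristic zero, m ≥ 2 an integer, and let d₂ be the derivation of k[x₁,x₂] with d₂(x₁) = x₁^m x₂ + g(x₁) and d₂(x₂) = x₁^{m-1}, where g ∈ k[x₁], deg g ≤ m, and gcd(x₁, g) = 1. Then for any n > 2 and g_j ∈ k[x_j] \ k (2 ≤ j ≤ n-1), the derivation d_n = d₂ + g₂(x₂)∂_{x₃} + … + g_{n-1}(x_{n-1})∂_{x_n} of k[x₁,…,x_n] is simple and Aut(k[x₁,…,x_n])_{d_n} = { (x₁,…,x_{n-1}, x_n + c) : c ∈ k }. -/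

import Mathlib

section DifferentialIdeals

variable {k A : Type*} [CommRing k] [CommRing A] [Algebra k A]

open Finset Nat in
/-- The general Leibniz rule for derivations of a commutative algebra. -/
theorem Derivation.iterate_apply_mul (D : Derivation k A A) (n : ℕ) (a b : A) :
    D^[n] (a * b) = ∑ ij ∈ antidiagonal n, choose n ij.1 • (D^[ij.1] a * D^[ij.2] b) := by
  induction n with
  | zero => simp
  | succ n ih =>
    rw [sum_antidiagonal_choose_succ_nsmul (M := A) (fun i j => D^[i] a * D^[j] b) n]
    simp only [Function.iterate_succ_apply', ih, map_sum, map_nsmul, D.leibniz, smul_eq_mul,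
      smul_add, sum_add_distrib]
    rw [add_right_inj]
    refine sum_congr rfl fun ⟨i, j⟩ hij ↦ ?_
    rw [n.choose_symm_of_eq_add (mem_antidiagonal.1 hij).symm, mul_comm]

/-- The largest ideal stable under the derivation `D` contained in the ideal `M`. -/
def Derivation.idealCore (D : Derivation k A A) (M : Ideal A) : Ideal A where
  carrier := {a | ∀ i, D^[i] a ∈ M}
  add_mem' ha hb i := by
    rw [iterate_map_add]
    exact M.add_mem (ha i) (hb i)
  zero_mem' i := by simp [iterate_map_zero]
  smul_mem' c a ha i := by
    rw [smul_eq_mul, D.iterate_apply_mul]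
    exact M.sum_mem fun ij _ ↦ M.nsmul_mem (M.mul_mem_left _ (ha _)) _

theorem Derivation.mem_idealCore {D : Derivation k A A} {M : Ideal A} {a : A} :
    a ∈ D.idealCore M ↔ ∀ i, D^[i] a ∈ M := Iff.rfl

theorem Derivation.isPrime_idealCore [Algebra ℚ A] (D : Derivation k A A) (M : Ideal A)
    [hM : M.IsPrime] : (D.idealCore M).IsPrime := by
  classical
  refine ⟨fun h ↦ hM.ne_top ?_, ?_⟩
  · rw [Ideal.eq_top_iff_one] at h ⊢
    exact h 0
  intro a b hab
  by_contra! hcon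
  obtain ⟨ha, hb⟩ := hcon
  simp only [mem_idealCore, not_forall] at ha hb
  have h := hab (Nat.find ha + Nat.find hb)
  rw [D.iterate_apply_mul, ← Finset.add_sum_erase _ _
    (Finset.HasAntidiagonal.mem_antidiagonal (a := (Nat.find ha, Nat.find hb)).2 rfl)] at h
  rw [Ideal.add_mem_iff_left] at h
  · rw [nsmul_eq_mul] at h
    have hu : IsUnit (((Nat.find ha + Nat.find hb).choose (Nat.find ha) : ℕ) : A) := by
      have := (IsUnit.mk0 (((Nat.find ha + Nat.find hb).choose (Nat.find ha) : ℕ) : ℚ)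
        (by exact_mod_cast (Nat.choose_pos (Nat.le_add_right _ _)).ne')).map (algebraMap ℚ A)
      simpa using this
    rw [Ideal.unit_mul_mem_iff_mem _ hu] at h
    exact (hM.mem_or_mem h).elim (Nat.find_spec ha) (Nat.find_spec hb)
  · refine M.sum_mem fun ij hij ↦ M.nsmul_mem ?_ _
    obtain ⟨hne, hij⟩ := Finset.mem_erase.1 hij
    simp only [Finset.HasAntidiagonal.mem_antidiagonal] at hij
    rcases lt_or_ge ij.1 (Nat.find ha) with h1 | h1
    · exact M.mul_mem_right _ (not_not.1 (Nat.find_min ha h1))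
    · refine M.mul_mem_left _ (not_not.1 (Nat.find_min hb ?_))
      by_contra! h2
      exact hne (Prod.ext (by simp; omega) (by simp; omega))

theorem Derivation.exists_prime_stable_ge [Algebra ℚ A] (D : Derivation k A A) (I : Ideal A)
    (hI : ∀ f ∈ I, D f ∈ I) (hne : I ≠ ⊤) :
    ∃ P : Ideal A, P.IsPrime ∧ I ≤ P ∧ ∀ f ∈ P, D f ∈ P := by
  obtain ⟨M, hM, hIM⟩ := Ideal.exists_le_maximal I hne
  refine ⟨D.idealCore M, have := hM.isPrime; D.isPrime_idealCore M, fun f hf i ↦ hIM ?_,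
    fun f hf i ↦ ?_⟩
  · induction i with
    | zero => exact hf
    | succ i ih =>
      rw [Function.iterate_succ_apply']
      exact hI _ ih
  · rw [← Function.iterate_succ_apply]
    exact hf _

end DifferentialIdeals

section PolynomialDerivations

open Polynomial

variable {k A : Type*} [CommRing k] [CommRing A] [Algebra k A]

/-- The derivation of `A[X]` applying `d` to each coefficient. -/
noncomputable def Derivation.coeffwise (d : Derivation k A A) : Derivation k A[X] A[X] :=
  PolynomialModule.equivPolynomialSelf.toLinearMap.compDer d.mapCoeffs

@[simp]
theorem Derivation.coeff_coeffwise (d : Derivation k A A) (p : A[X]) (i : ℕ) :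
    (d.coeffwise p).coeff i = d (p.coeff i) := rfl

@[simp]
theorem Derivation.coeffwise_C (d : Derivation k A A) (a : A) :
    d.coeffwise (C a) = C (d a) := by
  ext i
  simp only [coeff_coeffwise, coeff_C]
  split_ifs <;> simp

@[simp]
theorem Derivation.coeffwise_X (d : Derivation k A A) : d.coeffwise (X : A[X]) = 0 := by
  ext i
  simp only [coeff_coeffwise, coeff_X]
  split_ifs <;> simp

/-- The derivation of `A[X]` extending `d` with value `a` at `X`. -/
noncomputable def Derivation.extendPoly (d : Derivation k A A) (a : A) : Derivation k A[X] A[X] :=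
  d.coeffwise + C a • derivative'.restrictScalars k

theorem Derivation.extendPoly_apply (d : Derivation k A A) (a : A) (p : A[X]) :
    d.extendPoly a p = d.coeffwise p + C a * derivative p := rfl

@[simp]
theorem Derivation.extendPoly_C (d : Derivation k A A) (a b : A) :
    d.extendPoly a (C b) = C (d b) := by
  simp [extendPoly_apply]

@[simp]
theorem Derivation.extendPoly_X (d : Derivation k A A) (a : A) :
    d.extendPoly a X = C a := by
  simp [extendPoly_apply]

theorem Derivation.coeff_extendPoly (d : Derivation k A A) (a : A) (p : A[X]) (i : ℕ) :
    (d.extendPoly a p).coeff i = d (p.coeff i) + (i + 1) * p.coeff (i + 1) * a := by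
  rw [extendPoly_apply, coeff_add, coeff_coeffwise, coeff_C_mul, coeff_derivative]
  ring

theorem Derivation.natDegree_extendPoly_le (d : Derivation k A A) (a : A) (p : A[X]) :
    (d.extendPoly a p).natDegree ≤ p.natDegree := by
  refine natDegree_le_iff_coeff_eq_zero.2 fun i hi ↦ ?_
  rw [coeff_extendPoly, coeff_eq_zero_of_natDegree_lt hi,
    coeff_eq_zero_of_natDegree_lt (Nat.lt_succ_of_lt hi)]
  simp

theorem Derivation.aeval_apply (d : Derivation k A A) (p : k[X]) (a : A) :
    d (aeval a p) = aeval a (derivative p) * d a := by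
  induction p using Polynomial.induction_on' with
  | add p q hp hq => simp [hp, hq, add_mul]
  | monomial n c =>
    simp [aeval_monomial, derivative_monomial, Derivation.leibniz_pow, Derivation.leibniz]
    ring

theorem natDegree_aeval_le (p : k[X]) (f : A[X]) :
    (aeval f p).natDegree ≤ p.natDegree * f.natDegree := by
  rw [aeval_eq_sum_range]
  refine natDegree_sum_le_of_forall_le _ _ fun i hi ↦ (natDegree_smul_le _ _).trans ?_
  exact natDegree_pow_le.trans
    (Nat.mul_le_mul_right _ (Nat.lt_succ_iff.1 (Finset.mem_range.1 hi)))

theorem coeff_aeval_X (p : k[X]) (i : ℕ) :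
    (aeval (X : A[X]) p).coeff i = algebraMap k A (p.coeff i) := by
  rw [aeval_X_left_eq_map, coeff_map]

end PolynomialDerivations

section Tower

open Polynomial

/-- The properties of a derivation `d` of `A = k[x₀,…,xₙ₋₁]` with
`d x₀ = x₀ ^ m * x₁ + g(x₀)`, `d x₁ = x₀ ^ (m - 1)` and `d xⱼ = Gⱼ(xⱼ₋₁)` for `j ≥ 2`
that pass from `n` to `n + 1` variables. -/
structure IsTowerStage {k A : Type*} [Field k] [CommRing A] [Algebra k A] (m : ℕ) (g : k[X])
    (G : ℕ → k[X]) (n : ℕ) (d : Derivation k A A) (x : ℕ → A) : Prop where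
  map_x_zero : d (x 0) = x 0 ^ m * x 1 + aeval (x 0) g
  map_x_one : d (x 1) = x 0 ^ (m - 1)
  map_x_var : ∀ j, 2 ≤ j → j < n → d (x j) = aeval (x (j - 1)) (G j)
  transcendental : ∀ j < n, Transcendental k (x j)
  simple : ∀ I : Ideal A, (∀ f ∈ I, d f ∈ I) → I = ⊥ ∨ I = ⊤
  eq_const_of_map_eq_aeval_last : ∀ (b : A) (h : k[X]), d b = aeval (x (n - 1)) h →
    ∃ c, b = algebraMap k A c
  natDegree_eq_zero_of_map_eq_add : ∀ (j : ℕ) (b : A) (u h : k[X]), 2 ≤ j → j < n →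
    d b = aeval (x (j - 1)) u + aeval (x (n - 1)) h → h.natDegree = 0
  eq_const_of_natDegree_lt : ∀ (j : ℕ) (b : A) (u : k[X]), 2 ≤ j → j < n →
    u.natDegree < (G j).natDegree → d b = aeval (x (j - 1)) u → ∃ c, b = algebraMap k A c
  eq_of_commute : ∀ f h : A, f ≠ 0 → d f = f ^ m * h + aeval f g → d h = f ^ (m - 1) →
    f = x 0 ∧ h = x 1

namespace IsTowerStage

variable {k A : Type*} [Field k] [CommRing A] [Algebra k A]
  {m : ℕ} {g : k[X]} {G : ℕ → k[X]} {n : ℕ} {d : Derivation k A A} {x : ℕ → A}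

theorem natDegree_eq_zero_of_aeval_eq_algebraMap {s : A} (hs : Transcendental k s) {h : k[X]}
    {c : k} (hc : aeval s h = algebraMap k A c) : h.natDegree = 0 := by
  have : h = C c := (transcendental_iff_injective.1 hs) (by simpa using hc)
  rw [this, natDegree_C]

theorem const_of_map_eq_const (S : IsTowerStage m g G n d x) {b : A} {c : k}
    (hb : d b = algebraMap k A c) : ∃ c', b = algebraMap k A c' :=
  S.eq_const_of_map_eq_aeval_last b (C c) (by simpa using hb)

/-- A constant multiple of the value of the next variable has no primitive, up to constants. -/
theorem eq_zero_of_map_add_eq_const (S : IsTowerStage m g G n d x) (hn : 2 ≤ n)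
    {p : k[X]} (hp : 0 < p.natDegree) {b : A} {c e : k}
    (hb : d b + algebraMap k A e * aeval (x (n - 1)) p = algebraMap k A c) : e = 0 := by
  have hd : d b = aeval (x (n - 1)) (C c - C e * p) := by
    simp [← hb]
  obtain ⟨c', rfl⟩ := S.eq_const_of_map_eq_aeval_last _ _ hd
  by_contra he
  rw [Derivation.map_algebraMap] at hd
  have := natDegree_eq_zero_of_aeval_eq_algebraMap (S.transcendental (n - 1) (by omega))
    (hd.symm.trans (map_zero _).symm)
  rw [natDegree_sub_eq_right_of_natDegree_lt] at this
  · rw [natDegree_C_mul he] at this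
    omega
  · rwa [natDegree_C, natDegree_C_mul he]

/-- If the coefficients of `D b` are constant in positive degrees, then `b` is affine in the new
variable, with constant slope. -/
theorem exists_eq_affine [CharZero k] (S : IsTowerStage m g G n d x) (hn : 2 ≤ n) {p : k[X]}
    (hp : 0 < p.natDegree) (b : A[X])
    (hb : ∀ i, 0 < i → ∃ c : k, (d.extendPoly (aeval (x (n - 1)) p) b).coeff i = algebraMap k A c) :
    ∃ (e : k) (b₀ : A), b = C (algebraMap k A e) * X + C b₀ := by
  have htop : 0 < b.natDegree → ∃ c, b.coeff b.natDegree = algebraMap k A c := by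
    intro h
    obtain ⟨c, hc⟩ := hb _ h
    rw [Derivation.coeff_extendPoly, coeff_eq_zero_of_natDegree_lt (Nat.lt_succ_self _)] at hc
    exact S.const_of_map_eq_const (by simpa using hc)
  have hle : b.natDegree ≤ 1 := by
    by_contra! hlt
    obtain ⟨r, hr⟩ : ∃ r, b.natDegree = r + 1 := ⟨b.natDegree - 1, by omega⟩
    obtain ⟨e, he⟩ := htop (by omega)
    obtain ⟨c, hc⟩ := hb r (by omega)
    rw [Derivation.coeff_extendPoly, ← hr, he] at hc
    have h0 : ((r : k) + 1) * e = 0 :=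
      S.eq_zero_of_map_add_eq_const hn hp (b := b.coeff r) (c := c) (by simpa using hc)
    have : e = 0 := by
      rcases mul_eq_zero.1 h0 with h | h
      · exact absurd h (by exact_mod_cast Nat.succ_ne_zero r)
      · exact h
    rw [this, map_zero, coeff_natDegree, leadingCoeff_eq_zero] at he
    simp [he] at hr
  have hb1 := eq_X_add_C_of_natDegree_le_one hle
  rcases Nat.eq_zero_or_pos b.natDegree with h | h
  · exact ⟨0, b.coeff 0, by simpa using eq_C_of_natDegree_eq_zero h⟩
  · obtain ⟨c, hc⟩ := htop h
    rw [show b.natDegree = 1 by omega] at hc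
    exact ⟨c, b.coeff 0, by rw [← hc]; exact hb1⟩

theorem extendPoly_affine (d : Derivation k A A) (a : A) (e : k) (b₀ : A) :
    d.extendPoly a (C (algebraMap k A e) * X + C b₀) = C (algebraMap k A e * a + d b₀) := by
  simp [Derivation.leibniz]

/-- Adjoining a variable `X` with `D X = p(xₙ₋₁)` preserves simplicity. -/
theorem simple_extendPoly [CharZero k] [IsDomain A] (S : IsTowerStage m g G n d x) (hn : 2 ≤ n)
    {p : k[X]} (hp : 0 < p.natDegree) (I : Ideal A[X])
    (hI : ∀ f ∈ I, d.extendPoly (aeval (x (n - 1)) p) f ∈ I) : I = ⊥ ∨ I = ⊤ := by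
  classical
  refine or_iff_not_imp_left.2 fun hbot ↦ ?_
  have hex : ∃ r, ∃ f ∈ I, f ≠ 0 ∧ f.natDegree = r := by
    obtain ⟨f, hf, hf0⟩ := Submodule.exists_mem_ne_zero_of_ne_bot hbot
    exact ⟨_, f, hf, hf0, rfl⟩
  obtain ⟨f, hf, hf0, hfr⟩ := Nat.find_spec hex
  set r := Nat.find hex with hr
  have hmin : ∀ f ∈ I, f.natDegree ≤ r → f.coeff r = 0 → f = 0 := by
    intro f hf hle hc
    by_contra h0
    have hlt : f.natDegree < r := by
      refine lt_of_le_of_ne hle fun h ↦ h0 ?_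
      rwa [← h, coeff_natDegree, leadingCoeff_eq_zero] at hc
    exact Nat.find_min hex hlt ⟨f, hf, h0, rfl⟩
  have hcr : ∀ f : A[X], f.natDegree ≤ r →
      (d.extendPoly (aeval (x (n - 1)) p) f).coeff r = d (f.coeff r) := by
    intro f hf
    rw [Derivation.coeff_extendPoly, coeff_eq_zero_of_natDegree_lt (Nat.lt_succ_of_le hf)]
    simp
  have hL : I.leadingCoeffNth r = ⊤ := by
    have hmem : ∀ a, a ∈ I.leadingCoeffNth r ↔ ∃ f ∈ I, f.natDegree ≤ r ∧ f.coeff r = a := by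
      intro a
      simp only [Ideal.leadingCoeffNth, Submodule.mem_map, lcoeff_apply]
      constructor
      · rintro ⟨f, ⟨h1, h2⟩, h3⟩
        exact ⟨f, h2, natDegree_le_iff_degree_le.2 (mem_degreeLE.1 h1), h3⟩
      · rintro ⟨f, h1, h2, h3⟩
        exact ⟨f, ⟨mem_degreeLE.2 (natDegree_le_iff_degree_le.1 h2), h1⟩, h3⟩
    refine (S.simple _ fun a ha ↦ ?_).resolve_left fun h ↦ hf0 (hmin f hf hfr.le ?_)
    · obtain ⟨q, hq, hqr, rfl⟩ := (hmem a).1 ha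
      exact (hmem _).2 ⟨_, hI q hq, (Derivation.natDegree_extendPoly_le _ _ _).trans hqr, hcr q hqr⟩
    · have := (hmem (f.coeff r)).2 ⟨f, hf, hfr.le, rfl⟩
      rwa [h, Ideal.mem_bot] at this
  obtain ⟨q, hq, hqr, hq1⟩ : ∃ q ∈ I, q.natDegree ≤ r ∧ q.coeff r = 1 := by
    have h1 : (1 : A) ∈ I.leadingCoeffNth r := hL ▸ Submodule.mem_top
    rw [Ideal.mem_leadingCoeffNth] at h1
    obtain ⟨q, hq, hqd, hql⟩ := h1
    have hqr := natDegree_le_iff_degree_le.2 hqd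
    refine ⟨q, hq, hqr, ?_⟩
    by_contra hne
    rcases hqr.lt_or_eq with h | h
    · have := hmin q hq hqr (coeff_eq_zero_of_natDegree_lt h)
      simp [this] at hql
    · rw [← h] at hne
      exact hne hql
  have hD : d.extendPoly (aeval (x (n - 1)) p) q = 0 :=
    hmin _ (hI q hq) ((Derivation.natDegree_extendPoly_le _ _ _).trans hqr)
      (by rw [hcr q hqr, hq1, Derivation.map_one_eq_zero])
  obtain ⟨e, b₀, rfl⟩ := S.exists_eq_affine hn hp q fun i _ ↦ ⟨0, by simp [hD]⟩
  rw [extendPoly_affine, C_eq_zero] at hD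
  have he : e = 0 := S.eq_zero_of_map_add_eq_const hn hp (b := b₀) (c := 0)
    (by rw [map_zero, ← hD, add_comm])
  rw [he, map_zero, map_zero, zero_mul, zero_add] at hq hq1
  have hr0 : r = 0 := by
    by_contra h
    rw [coeff_C_of_ne_zero h] at hq1
    exact zero_ne_one hq1
  rw [hr0, coeff_C_zero] at hq1
  rw [Ideal.eq_top_iff_one]
  rwa [hq1, C_1] at hq

theorem eq_of_commute_extendPoly [IsDomain A] (S : IsTowerStage m g G n d x) (hm : 2 ≤ m)
    (hg : g.natDegree ≤ m) (a : A) {f h : A[X]} (hf0 : f ≠ 0)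
    (hf : d.extendPoly a f = f ^ m * h + aeval f g) (hh : d.extendPoly a h = f ^ (m - 1)) :
    f = C (x 0) ∧ h = C (x 1) := by
  have hdf := d.natDegree_extendPoly_le a f
  have hdh := d.natDegree_extendPoly_le a h
  rw [hf] at hdf
  rw [hh, natDegree_pow] at hdh
  have hgf : (aeval f g).natDegree ≤ m * f.natDegree :=
    (natDegree_aeval_le g f).trans (Nat.mul_le_mul_right _ hg)
  have hh0 : h.natDegree = 0 := by
    by_contra hne
    have h0 : h ≠ 0 := fun h' ↦ hne (by simp [h'])
    have hmul : (f ^ m * h).natDegree = m * f.natDegree + h.natDegree := by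
      rw [natDegree_mul (pow_ne_zero _ hf0) h0, natDegree_pow]
    rw [natDegree_add_eq_left_of_natDegree_lt (by omega), hmul] at hdf
    have := Nat.le_mul_of_pos_left f.natDegree (show 0 < m by omega)
    omega
  have hf0' : f.natDegree = 0 := by
    rw [hh0, Nat.le_zero, mul_eq_zero] at hdh
    omega
  obtain ⟨f, rfl⟩ : ∃ f', f = C f' := ⟨_, eq_C_of_natDegree_eq_zero hf0'⟩
  obtain ⟨h, rfl⟩ : ∃ h', h = C h' := ⟨_, eq_C_of_natDegree_eq_zero hh0⟩
  have haev : aeval (C f) g = C (aeval f g) := aeval_algHom_apply (CAlgHom (R := k)) f g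
  rw [Derivation.extendPoly_C, haev, ← C_pow, ← C_mul, ← C_add] at hf
  rw [Derivation.extendPoly_C, ← C_pow] at hh
  obtain ⟨rfl, rfl⟩ := S.eq_of_commute f h (fun h ↦ hf0 (by rw [h, C_0])) (C_injective hf)
    (C_injective hh)
  exact ⟨rfl, rfl⟩

theorem extend [CharZero k] [IsDomain A] (S : IsTowerStage m g G n d x) (hm : 2 ≤ m)
    (hg : g.natDegree ≤ m) (hn : 2 ≤ n) (hG : 0 < (G n).natDegree) :
    IsTowerStage m g G (n + 1) (d.extendPoly (aeval (x (n - 1)) (G n)))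
      (fun j ↦ if j < n then C (x j) else X) := by
  have haev : ∀ (s : A) (q : k[X]), aeval (C s) q = C (aeval s q) := fun s q ↦
    aeval_algHom_apply (CAlgHom (R := k)) s q
  have hconst : ∀ c, algebraMap k A[X] c = C (algebraMap k A c) := fun _ ↦ rfl
  have hlt : ∀ j, 2 ≤ j → j < n + 1 → j - 1 < n := fun j _ _ ↦ by omega
  refine ⟨?_, ?_, ?_, ?_, S.simple_extendPoly hn hG, ?_, ?_, ?_, ?_⟩
  · simp only [show 0 < n by omega, show 1 < n by omega, if_true, Derivation.extendPoly_C,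
      S.map_x_zero, haev, map_add, map_mul, map_pow]
  · simp only [show 0 < n by omega, show 1 < n by omega, if_true, Derivation.extendPoly_C,
      S.map_x_one, map_pow]
  · intro j h2 hj
    simp only [hlt j h2 hj, if_true]
    split_ifs with h
    · rw [Derivation.extendPoly_C, S.map_x_var j h2 h, haev]
    · obtain rfl : j = n := by omega
      rw [Derivation.extendPoly_X, haev]
  · intro j hj
    split_ifs with h
    · rw [transcendental_iff]
      intro q hq
      rw [haev, C_eq_zero] at hq
      exact transcendental_iff.1 (S.transcendental j h) q hq
    · rw [transcendental_iff]
      intro q hq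
      ext i
      have := congrArg (coeff · i) hq
      simp only [coeff_aeval_X, coeff_zero] at this ⊢
      exact (map_eq_zero _).1 this
  · intro b h hb
    simp only [Nat.add_sub_cancel, lt_irrefl, if_false] at hb
    obtain ⟨e, b₀, rfl⟩ := S.exists_eq_affine hn hG b fun i _ ↦ ⟨h.coeff i, by
      rw [hb, coeff_aeval_X]⟩
    have h0 := congrArg (coeff · 0) hb
    simp only [extendPoly_affine, coeff_C_zero, coeff_aeval_X] at h0
    have he : e = 0 := S.eq_zero_of_map_add_eq_const hn hG (b := b₀) (c := h.coeff 0)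
      (by rw [← h0, add_comm])
    rw [he, map_zero, zero_mul, zero_add] at h0
    obtain ⟨c, rfl⟩ := S.const_of_map_eq_const h0
    exact ⟨c, by simp [he, hconst]⟩
  · intro j b u h h2 hj hb
    simp only [Nat.add_sub_cancel, lt_irrefl, if_false, hlt j h2 hj, if_true, haev] at hb
    have hcoeff : ∀ i, 0 < i → (d.extendPoly (aeval (x (n - 1)) (G n)) b).coeff i =
        algebraMap k A (h.coeff i) := fun i hi ↦ by
      rw [hb, coeff_add, coeff_C_of_ne_zero hi.ne', zero_add, coeff_aeval_X]
    obtain ⟨e, b₀, rfl⟩ := S.exists_eq_affine hn hG b fun i hi ↦ ⟨_, hcoeff i hi⟩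
    rw [← Nat.le_zero, natDegree_le_iff_coeff_eq_zero]
    intro i hi
    have := hcoeff i hi
    rw [extendPoly_affine, coeff_C_of_ne_zero hi.ne'] at this
    exact (map_eq_zero _).1 this.symm
  · intro j b u h2 hj hu hb
    simp only [hlt j h2 hj, if_true, haev] at hb
    obtain ⟨e, b₀, rfl⟩ := S.exists_eq_affine hn hG b fun i hi ↦ ⟨0, by
      rw [hb, coeff_C_of_ne_zero hi.ne', map_zero]⟩
    rw [extendPoly_affine] at hb
    have hb' := C_injective hb
    rcases (Nat.lt_succ_iff.1 hj).lt_or_eq with h | rfl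
    · have hdeg := S.natDegree_eq_zero_of_map_eq_add j b₀ u (-(C e * G n)) h2 h
        (by simp [← hb'])
      have he : e = 0 := by
        by_contra he
        rw [natDegree_neg, natDegree_C_mul he] at hdeg
        omega
      rw [he, map_zero, zero_mul, zero_add] at hb'
      obtain ⟨c, rfl⟩ := S.eq_const_of_natDegree_lt j b₀ u h2 h hu hb'
      exact ⟨c, by simp [he, hconst]⟩
    · have hd : d b₀ = aeval (x (j - 1)) (u - C e * G j) := by simp [← hb']
      obtain ⟨c, rfl⟩ := S.eq_const_of_map_eq_aeval_last _ _ hd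
      rw [Derivation.map_algebraMap] at hd
      have hdeg := natDegree_eq_zero_of_aeval_eq_algebraMap
        (S.transcendental (j - 1) (by omega)) (hd.symm.trans (map_zero _).symm)
      have he : e = 0 := by
        by_contra he
        rw [natDegree_sub_eq_right_of_natDegree_lt (by rwa [natDegree_C_mul he]),
          natDegree_C_mul he] at hdeg
        omega
      exact ⟨c, by simp [he, hconst]⟩
  · intro f h hf0 hf hh
    simpa only [show 0 < n by omega, show 1 < n by omega, if_true] using
      S.eq_of_commute_extendPoly hm hg _ hf0 hf hh

end IsTowerStage

end Tower

section PlaneDerivation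

open Polynomial

variable {k : Type*} [Field k]

/-- The derivation `(x ^ m * y + g(x)) ∂ₓ + x ^ (m - 1) ∂ᵧ` of `k[y][x]`; the outer variable
is `x`. -/
noncomputable def planeDeriv (m : ℕ) (g : k[X]) : Derivation k k[X][X] k[X][X] :=
  (X ^ (m - 1) : k[X][X]) • (derivative' : Derivation k k[X] k[X]).coeffwise +
    (X ^ m * C X + aeval X g : k[X][X]) •
      (derivative' : Derivation k[X] k[X][X] k[X][X]).restrictScalars k

theorem planeDeriv_apply (m : ℕ) (g : k[X]) (p : k[X][X]) :
    planeDeriv m g p = X ^ (m - 1) * (derivative' : Derivation k k[X] k[X]).coeffwise p +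
      (X ^ m * C X + aeval X g) * derivative p := rfl

theorem planeDeriv_C (m : ℕ) (g : k[X]) (F : k[X]) :
    planeDeriv m g (C F) = X ^ (m - 1) * C (derivative F) := by
  simp [planeDeriv_apply]

theorem planeDeriv_X (m : ℕ) (g : k[X]) :
    planeDeriv m g X = X ^ m * C X + aeval X g := by
  simp [planeDeriv_apply]

theorem natDegree_planeDeriv_coeff_le {m : ℕ} {g : k[X]} (hg : g.natDegree ≤ m) :
    (X ^ m * C X + aeval X g : k[X][X]).natDegree ≤ m := by
  refine natDegree_add_le_of_degree_le ?_ ?_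
  · refine natDegree_mul_le.trans ?_
    simp
  · rw [aeval_X_left_eq_map]
    exact natDegree_map_le.trans hg

theorem natDegree_coeffwise_le {A : Type*} [CommRing A] [Algebra k A] (d : Derivation k A A)
    (p : A[X]) : (d.coeffwise p).natDegree ≤ p.natDegree :=
  natDegree_le_iff_coeff_eq_zero.2 fun i hi ↦ by
    rw [Derivation.coeff_coeffwise, coeff_eq_zero_of_natDegree_lt hi, map_zero]

theorem natDegree_planeDeriv_le {m : ℕ} (hm : 2 ≤ m) {g : k[X]} (hg : g.natDegree ≤ m)
    (p : k[X][X]) : (planeDeriv m g p).natDegree ≤ p.natDegree + (m - 1) := by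
  rw [planeDeriv_apply]
  refine natDegree_add_le_of_degree_le ?_ ?_
  · refine natDegree_mul_le.trans ?_
    have := natDegree_coeffwise_le derivative' p
    rw [natDegree_X_pow]
    omega
  · rcases Nat.eq_zero_or_pos p.natDegree with h | h
    · rw [derivative_of_natDegree_zero h]
      simp
    · refine natDegree_mul_le.trans ?_
      have := natDegree_planeDeriv_coeff_le hg
      have := natDegree_derivative_le p
      omega

theorem coeff_planeDeriv {m : ℕ} (hm : 2 ≤ m) {g : k[X]} (hg : g.natDegree ≤ m)
    (p : k[X][X]) : (planeDeriv m g p).coeff (p.natDegree + (m - 1)) =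
      derivative p.leadingCoeff +
        (p.natDegree : k[X]) * (X + C (g.coeff m)) * p.leadingCoeff := by
  rw [planeDeriv_apply, coeff_add, coeff_X_pow_mul, Derivation.coeff_coeffwise, derivative'_apply,
    coeff_natDegree]
  congr 1
  rcases Nat.eq_zero_or_pos p.natDegree with h | h
  · rw [derivative_of_natDegree_zero h, h]
    simp
  · rw [show p.natDegree + (m - 1) = m + (p.natDegree - 1) by omega,
      coeff_mul_add_eq_of_natDegree_le (natDegree_planeDeriv_coeff_le hg) (natDegree_derivative_le p),
      coeff_derivative, show p.natDegree - 1 + 1 = p.natDegree by omega, coeff_add,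
      coeff_aeval_X, coeff_natDegree, ← Nat.cast_succ, Nat.succ_eq_add_one,
      show p.natDegree - 1 + 1 = p.natDegree by omega]
    have : (X ^ m * C X : k[X][X]).coeff m = X := by simp
    rw [this, algebraMap_eq]
    ring

variable [CharZero k]

theorem natDegree_planeDeriv {m : ℕ} (hm : 2 ≤ m) {g : k[X]} (hg : g.natDegree ≤ m)
    {p : k[X][X]} (hp : 0 < p.natDegree) :
    (planeDeriv m g p).natDegree = p.natDegree + (m - 1) := by
  refine natDegree_eq_of_le_of_coeff_ne_zero (natDegree_planeDeriv_le hm hg p) fun h ↦ ?_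
  rw [coeff_planeDeriv hm hg] at h
  have hF : p.leadingCoeff ≠ 0 := leadingCoeff_ne_zero.2 fun h ↦ by simp [h] at hp
  have hdvd : p.leadingCoeff ∣ derivative p.leadingCoeff :=
    ⟨-((p.natDegree : k[X]) * (X + C (g.coeff m))), by linear_combination h⟩
  rw [dvd_derivative_iff.1 hdvd, zero_add] at h
  have hN : (p.natDegree : k[X]) ≠ 0 := by exact_mod_cast hp.ne'
  exact mul_ne_zero (mul_ne_zero hN (X_add_C_ne_zero _)) hF h

theorem eq_const_of_planeDeriv_eq_C {m : ℕ} (hm : 2 ≤ m) {g : k[X]} (hg : g.natDegree ≤ m)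
    {b : k[X][X]} {h : k[X]} (hb : planeDeriv m g b = C h) : ∃ c : k, b = C (C c) := by
  have hb0 : b.natDegree = 0 := by
    by_contra hne
    have := natDegree_planeDeriv hm hg (Nat.pos_of_ne_zero hne)
    rw [hb, natDegree_C] at this
    omega
  obtain ⟨F, rfl⟩ : ∃ F, b = C F := ⟨_, eq_C_of_natDegree_eq_zero hb0⟩
  rw [planeDeriv_C] at hb
  have := congrArg (coeff · (m - 1)) hb
  simp only [coeff_X_pow_mul', le_refl, if_true, Nat.sub_self, coeff_C_zero,
    coeff_C_of_ne_zero (show m - 1 ≠ 0 by omega)] at this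
  exact ⟨F.coeff 0, congrArg C (eq_C_of_derivative_eq_zero this)⟩

theorem eq_of_planeDeriv_commute {m : ℕ} (hm : 2 ≤ m) {g : k[X]} (hg : g.natDegree ≤ m)
    (hg0 : g.coeff 0 ≠ 0) {f h : k[X][X]} (hf0 : f ≠ 0)
    (hf : planeDeriv m g f = f ^ m * h + aeval f g) (hh : planeDeriv m g h = f ^ (m - 1)) :
    f = X ∧ h = C X := by
  rcases Nat.eq_zero_or_pos f.natDegree with hfd | hfd
  · exfalso
    rcases Nat.eq_zero_or_pos h.natDegree with hhd | hhd
    · rw [eq_C_of_natDegree_eq_zero hhd, planeDeriv_C] at hh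
      have h0 := congrArg (coeff · 0) hh
      simp only [mul_coeff_zero, coeff_X_pow, show (0 : ℕ) ≠ m - 1 by omega, if_false,
        zero_mul] at h0
      rw [eq_C_of_natDegree_eq_zero hfd, ← C_pow, coeff_C_zero] at h0
      have := (pow_eq_zero_iff (by omega)).1 h0.symm
      rw [eq_C_of_natDegree_eq_zero hfd, this, C_0] at hf0
      exact hf0 rfl
    · have := natDegree_planeDeriv hm hg hhd
      rw [hh, natDegree_pow, hfd] at this
      omega
  · have hfD := natDegree_planeDeriv hm hg hfd
    have hgf : (aeval f g).natDegree ≤ m * f.natDegree :=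
      (natDegree_aeval_le g f).trans (Nat.mul_le_mul_right _ hg)
    have hhd : h.natDegree = 0 := by
      by_contra hne
      have h0 : h ≠ 0 := fun h' ↦ hne (by simp [h'])
      have hmul : (f ^ m * h).natDegree = m * f.natDegree + h.natDegree := by
        rw [natDegree_mul (pow_ne_zero _ hf0) h0, natDegree_pow]
      rw [hf, natDegree_add_eq_left_of_natDegree_lt (by omega), hmul] at hfD
      obtain ⟨a, rfl⟩ : ∃ a, m = a + 2 := ⟨m - 2, by omega⟩
      obtain ⟨b, hb⟩ : ∃ b, f.natDegree = b + 1 := ⟨f.natDegree - 1, by omega⟩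
      rw [hb, show a + 2 - 1 = a + 1 by omega] at hfD
      have : h.natDegree + a * b + b = 0 := by linarith
      omega
    rw [eq_C_of_natDegree_eq_zero hhd, planeDeriv_C] at hh
    have hdvd : X ∣ f := by
      refine prime_X.dvd_of_dvd_pow (n := m - 1) ?_
      rw [← hh]
      exact (dvd_pow_self _ (by omega)).mul_right _
    have hf1 : f.natDegree = 1 := by
      have h1 := natDegree_mul_C_le (X ^ (m - 1) : k[X][X]) (derivative (h.coeff 0))
      rw [hh, natDegree_pow, natDegree_X_pow] at h1
      have := Nat.le_of_mul_le_mul_left (h1.trans_eq (mul_one _).symm) (by omega)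
      omega
    obtain ⟨v, rfl⟩ := hdvd
    have hv0 : v ≠ 0 := right_ne_zero_of_mul hf0
    rw [natDegree_X_mul hv0] at hf1
    obtain ⟨V, rfl⟩ : ∃ V, v = C V := ⟨_, eq_C_of_natDegree_eq_zero (by omega)⟩
    have hV : V = 1 := by
      have h0 := congrArg (coeff · 0) hf
      have hgd : ∀ p : k[X][X], aeval p g = aeval p g.divX * p + C (C (g.coeff 0)) := by
        intro p
        conv_lhs => rw [← divX_mul_X_add g]
        simp [Polynomial.algebraMap_apply]
      rw [Derivation.leibniz, planeDeriv_X, planeDeriv_C, hgd X, hgd (X * C V)] at h0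
      simp only [coeff_add, mul_coeff_zero, coeff_X_zero, smul_eq_mul, zero_mul, mul_zero,
        mul_pow, coeff_X_pow, show (0 : ℕ) ≠ m by omega, if_false, coeff_C_zero, zero_add] at h0
      have hne : C (g.coeff 0) ≠ 0 := C_ne_zero.2 hg0
      exact mul_right_cancel₀ hne (h0.trans (one_mul _).symm)
    rw [hV, C_1, mul_one] at hf ⊢
    refine ⟨rfl, ?_⟩
    rw [planeDeriv_X] at hf
    exact (mul_left_cancel₀ (pow_ne_zero m X_ne_zero) (add_right_cancel hf)).symm

theorem eq_zero_of_aeval_mem_prime {A : Type*} [CommRing A] [Algebra k A]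
    {d : Derivation k A A} {m : ℕ} (hm : 2 ≤ m) {g : k[X]} (hg0 : g.coeff 0 ≠ 0) {x y : A}
    (hx : d x = x ^ m * y + aeval x g) (hy : d y = x ^ (m - 1)) (P : Ideal A) [hP : P.IsPrime]
    (hd : ∀ f ∈ P, d f ∈ P) {q : k[X]} (hq : aeval x q ∈ P) : q = 0 := by
  have hconst : ∀ c : k, algebraMap k A c ∈ P → c = 0 := by
    intro c hc
    by_contra hne
    exact hP.ne_top (P.eq_top_of_isUnit_mem hc ((IsUnit.mk0 c hne).map (algebraMap k A)))
  have hu : d x ∉ P := by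
    intro hu
    have hdu := hd _ hu
    rw [hx, map_add, Derivation.leibniz, Derivation.leibniz_pow, Derivation.aeval_apply, hy] at hdu
    have hxm : x ^ m * x ^ (m - 1) ∈ P := by
      have := P.sub_mem hdu (P.mul_mem_right (y * (m * x ^ (m - 1)) + aeval x (derivative g)) hu)
      convert this using 1
      simp only [smul_eq_mul, nsmul_eq_mul]
      ring
    rw [← pow_add] at hxm
    have hxP : x ∈ P := hP.mem_of_pow_mem _ hxm
    rw [hx, ← divX_mul_X_add g, map_add, map_mul, aeval_X, aeval_C, ← add_assoc] at hu
    refine hg0 (hconst _ ((P.add_mem_iff_right ?_).1 hu))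
    exact P.add_mem (P.mul_mem_right _ (P.pow_mem_of_mem hxP _ (by omega)))
      (P.mul_mem_left _ hxP)
  induction hr : q.natDegree using Nat.strong_induction_on generalizing q with
  | _ r ih =>
    rcases Nat.eq_zero_or_pos r with h | h
    · rw [eq_C_of_natDegree_eq_zero (hr.trans h)] at hq ⊢
      rw [aeval_C] at hq
      rw [hconst _ hq, C_0]
    · have hq' := hd _ hq
      rw [Derivation.aeval_apply] at hq'
      have := ih _ (hr ▸ natDegree_derivative_lt (by omega))
        ((hP.mem_or_mem hq').resolve_right hu) rfl
      have := derivative_eq_zero.1 this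
      omega

end PlaneDerivation

section PlaneSimplicity

open Polynomial Polynomial.Bivariate

variable {k : Type*} [Field k]

theorem coeff_coeff_swap (p : k[X][X]) (i j : ℕ) :
    ((swap p).coeff i).coeff j = (p.coeff j).coeff i := by
  induction p using Polynomial.induction_on' with
  | add p q hp hq => simp [hp, hq]
  | monomial n a =>
    induction a using Polynomial.induction_on' with
    | add p q hp hq => simp [hp, hq]
    | monomial l c =>
      rw [swap_monomial_monomial]
      simp only [coeff_monomial]
      split_ifs <;> simp [coeff_monomial, *]

theorem coeff_swap_planeDeriv (m : ℕ) (g : k[X]) (p : k[X][X]) (i : ℕ) :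
    (swap (planeDeriv m g p)).coeff (i + 1) =
      X ^ (m - 1) * ((swap p).coeff (i + 2) * ((i + 2 : ℕ) : k[X])) +
        (X ^ m * derivative ((swap p).coeff i) + g * derivative ((swap p).coeff (i + 1))) := by
  have h1 : swap ((derivative' : Derivation k k[X] k[X]).coeffwise p) = derivative (swap p) := by
    ext i j
    simp only [coeff_coeff_swap, coeff_derivative, Derivation.coeff_coeffwise, derivative'_apply,
      ← Nat.cast_succ, coeff_mul_natCast]
  have h2 : swap (derivative p) =
      (derivative' : Derivation k k[X] k[X]).coeffwise (swap p) := by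
    ext i j
    simp only [coeff_coeff_swap, coeff_derivative, Derivation.coeff_coeffwise, derivative'_apply,
      ← Nat.cast_succ, coeff_mul_natCast]
  have h3 : swap (planeDeriv m g p) = C (X ^ (m - 1)) * derivative (swap p) +
      (C (X ^ m) * X + C g) * (derivative' : Derivation k k[X] k[X]).coeffwise (swap p) := by
    rw [planeDeriv_apply, map_add, map_mul, map_mul, map_add, map_mul, map_pow, map_pow, swap_X,
      swap_Y, h1, h2, aeval_X_left_eq_map, algebraMap_eq, swap_map_C, C_pow, C_pow]
  rw [h3, add_mul, mul_assoc, coeff_add, coeff_add, coeff_C_mul, coeff_C_mul, coeff_C_mul,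
    coeff_X_mul, coeff_derivative]
  simp only [Derivation.coeff_coeffwise, derivative'_apply]
  push_cast
  ring

theorem aeval_C_X (h : k[X]) : aeval (C X : k[X][X]) h = C h := by
  simpa using aeval_algHom_apply (CAlgHom (R := k)) (X : k[X]) h

/-- If `f` has minimal `y`-degree among the nonzero elements of a stable ideal, then `f` divides
its derivative up to a factor from `k[x]`. -/
theorem exists_planeDeriv_mul_eq {m : ℕ} {g : k[X]} {I : Ideal k[X][X]}
    (hI : ∀ q ∈ I, planeDeriv m g q ∈ I) {f : k[X][X]} (hf : f ∈ I)
    (hmin : ∀ q ∈ I, q ≠ 0 → (swap f).natDegree ≤ (swap q).natDegree) {a : k[X]}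
    (ha : (swap f).leadingCoeff = a) :
    ∃ b : k[X], a.map C ^ 2 * planeDeriv m g f =
      ((X ^ m * (a * derivative a)).map C * C X + b.map C) * f := by
  set r := (swap f).natDegree with hr
  have hzero : ∀ q ∈ I, (swap q).natDegree ≤ r → (swap q).coeff r = 0 → q = 0 := by
    intro q hq hqr hc
    by_contra h0
    rw [(hmin q hq h0).antisymm hqr, coeff_natDegree, leadingCoeff_eq_zero] at hc
    exact h0 (by simpa using hc)
  have hfr : ∀ i, r < i → (swap f).coeff i = 0 := fun i hi ↦ coeff_eq_zero_of_natDegree_lt hi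
  have har : (swap f).coeff r = a := ha
  set h := a.map C * planeDeriv m g f - (X ^ m * derivative a).map C * C X * f with hh
  have hhI : h ∈ I := I.sub_mem (I.mul_mem_left _ (hI f hf)) (I.mul_mem_left _ hf)
  have hsh : ∀ i, (swap h).coeff (i + 1) = a * (swap (planeDeriv m g f)).coeff (i + 1) -
      X ^ m * derivative a * (swap f).coeff i := by
    intro i
    rw [hh, map_sub, map_mul, map_mul, map_mul, swap_map_C, swap_map_C, swap_X, coeff_sub,
      mul_assoc, coeff_C_mul, coeff_C_mul, coeff_X_mul]
  have hhr : (swap h).natDegree ≤ r := by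
    refine natDegree_le_iff_coeff_eq_zero.2 fun i hi ↦ ?_
    obtain ⟨i, rfl⟩ : ∃ l, i = l + 1 := ⟨i - 1, by omega⟩
    rw [hsh, coeff_swap_planeDeriv, hfr (i + 2) (by omega), hfr (i + 1) hi]
    rcases (Nat.lt_succ_iff.1 hi).eq_or_lt with rfl | hi'
    · rw [har]
      simp only [map_zero]
      ring
    · rw [hfr i hi']
      simp
  have h2 := hzero (a.map C * h - ((swap h).coeff r).map C * f)
    (I.sub_mem (I.mul_mem_left _ hhI) (I.mul_mem_left _ hf))
  rw [map_sub, map_mul, map_mul, swap_map_C, swap_map_C] at h2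
  have h3 := h2 (natDegree_sub_le_of_le ((natDegree_C_mul_le _ _).trans hhr)
    (natDegree_C_mul_le _ (swap f)) |>.trans (max_self r).le)
    (by rw [coeff_sub, coeff_C_mul, coeff_C_mul, har, mul_comm, sub_self])
  refine ⟨(swap h).coeff r, ?_⟩
  simp only [Polynomial.map_mul] at hh ⊢
  linear_combination h3 - a.map C * hh

variable [CharZero k]

theorem eq_map_C_of_planeDeriv_mul_eq {m : ℕ} (hm : 2 ≤ m) {g : k[X]} (hg : g.natDegree ≤ m)
    {f : k[X][X]} (hf0 : f ≠ 0) {a b : k[X]} (ha : (swap f).leadingCoeff = a)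
    (h : a.map C ^ 2 * planeDeriv m g f =
      ((X ^ m * (a * derivative a)).map C * C X + b.map C) * f) : f = a.map C := by
  set F := f.leadingCoeff with hF
  have hF0 : F ≠ 0 := leadingCoeff_ne_zero.2 hf0
  have ha0 : a ≠ 0 := by
    rw [← ha, leadingCoeff_ne_zero]
    simpa using hf0
  set s := a.natDegree with hs
  set c := a.leadingCoeff with hc
  have hc0 : c ≠ 0 := leadingCoeff_ne_zero.2 ha0
  set L := (X ^ m * (a * derivative a)).map C * C X + b.map C with hL
  have hLc : ∀ i, L.coeff i = C ((X ^ m * (a * derivative a)).coeff i) * X + C (b.coeff i) := by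
    intro i
    rw [hL, coeff_add, coeff_mul_C, coeff_map, coeff_map]
  have has : (a.map C ^ 2 : k[X][X]).natDegree ≤ 2 * s := by
    rw [natDegree_pow, natDegree_map_eq_of_injective C_injective]
  have hlead : (a.map C ^ 2 : k[X][X]).coeff (2 * s) = C (c ^ 2) := by
    rw [coeff_pow_of_natDegree_le natDegree_map_le, coeff_map, C_pow]
    rfl
  have hLdeg : L.natDegree ≤ 2 * s + (m - 1) := by
    by_cases hL0 : L = 0
    · simp [hL0]
    · have h1 := natDegree_mul hL0 hf0
      rw [← h] at h1
      have h2 := natDegree_mul_le_of_le has (natDegree_planeDeriv_le hm hg f)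
      omega
  have hcoef : (X ^ m * (a * derivative a)).coeff (2 * s + (m - 1)) = s * c ^ 2 := by
    rcases Nat.eq_zero_or_pos s with h0 | h0
    · rw [derivative_of_natDegree_zero (hs ▸ h0), h0]
      simp
    · rw [show 2 * s + (m - 1) = s + (s - 1) + m by omega, coeff_X_pow_mul,
        coeff_mul_add_eq_of_natDegree_le le_rfl (natDegree_derivative_le a), coeff_derivative,
        show s - 1 + 1 = s by omega, Nat.cast_sub h0]
      change c * (c * _) = _
      push_cast
      ring
  have key := congrArg (coeff · (2 * s + (f.natDegree + (m - 1)))) h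
  beta_reduce at key
  rw [coeff_mul_add_eq_of_natDegree_le has (natDegree_planeDeriv_le hm hg f), hlead,
    coeff_planeDeriv hm hg, show 2 * s + (f.natDegree + (m - 1)) = 2 * s + (m - 1) + f.natDegree by
      omega, coeff_mul_add_eq_of_natDegree_le hLdeg le_rfl, hLc, hcoef, coeff_natDegree, ← hF]
    at key
  set β := b.coeff (2 * s + (m - 1))
  have hinv : C (c ^ 2)⁻¹ * C (c ^ 2) = (1 : k[X]) := by
    rw [← C_mul, inv_mul_cancel₀ (pow_ne_zero 2 hc0), C_1]
  have hder : derivative F = 0 := by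
    refine dvd_derivative_iff.1 ⟨C (c ^ 2)⁻¹ * (C (s * c ^ 2) * X + C β) -
      (f.natDegree : k[X]) * (X + C (g.coeff m)), ?_⟩
    linear_combination C (c ^ 2)⁻¹ * key - (derivative F +
      (f.natDegree : k[X]) * (X + C (g.coeff m)) * F) * hinv
  have hNs : f.natDegree = s := by
    rw [hder, zero_add, ← mul_assoc] at key
    have h1 := congrArg (coeff · 1) (mul_right_cancel₀ hF0 key)
    rw [← C_eq_natCast, coeff_C_mul, coeff_C_mul, coeff_add, coeff_add, coeff_C_mul, coeff_X_one,
      coeff_C_of_ne_zero one_ne_zero, coeff_C_of_ne_zero one_ne_zero, mul_comm] at h1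
    simpa [hc0] using h1
  obtain ⟨e, he⟩ : ∃ e, F = C e := ⟨_, eq_C_of_derivative_eq_zero hder⟩
  have hr : (swap f).natDegree = 0 := by
    by_contra hr
    have h1 := coeff_coeff_swap f (swap f).natDegree s
    rw [coeff_natDegree, ha, ← hNs, coeff_natDegree, ← hF, he, coeff_C_of_ne_zero hr, hNs] at h1
    exact hc0 h1
  rw [← swap_C, ← ha, leadingCoeff, hr, ← eq_C_of_natDegree_eq_zero hr, swap_swap_apply]

theorem planeDeriv_simple {m : ℕ} (hm : 2 ≤ m) {g : k[X]} (hg : g.natDegree ≤ m)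
    (hg0 : g.coeff 0 ≠ 0) (I : Ideal k[X][X]) (hI : ∀ f ∈ I, planeDeriv m g f ∈ I) :
    I = ⊥ ∨ I = ⊤ := by
  classical
  by_contra! hne
  obtain ⟨P, hP, hIP, hPd⟩ := (planeDeriv m g).exists_prime_stable_ge I hI hne.2
  obtain ⟨f₀, hf₀, hf₀0⟩ := Submodule.exists_mem_ne_zero_of_ne_bot hne.1
  have hex : ∃ r, ∃ f ∈ P, f ≠ 0 ∧ (swap f).natDegree = r := ⟨_, f₀, hIP hf₀, hf₀0, rfl⟩
  obtain ⟨f, hf, hf0, hfr⟩ := Nat.find_spec hex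
  obtain ⟨b, hb⟩ := exists_planeDeriv_mul_eq hPd hf
    (fun q hq hq0 ↦ hfr ▸ Nat.find_min' hex ⟨q, hq, hq0, rfl⟩) rfl
  have hfa := eq_map_C_of_planeDeriv_mul_eq hm hg hf0 rfl hb
  rw [hfa, ← algebraMap_eq, ← aeval_X_left_eq_map] at hf
  have := eq_zero_of_aeval_mem_prime hm hg0 (planeDeriv_X m g)
    (by rw [planeDeriv_C, derivative_X, C_1, mul_one]) P hPd hf
  rw [hfa, this, Polynomial.map_zero] at hf0
  exact hf0 rfl

theorem isTowerStage_planeDeriv {m : ℕ} (hm : 2 ≤ m) {g : k[X]} (hg : g.natDegree ≤ m)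
    (hg0 : g.coeff 0 ≠ 0) (G : ℕ → k[X]) :
    IsTowerStage m g G 2 (planeDeriv m g) (fun j ↦ if j = 0 then X else C X) where
  map_x_zero := by simp [planeDeriv_X]
  map_x_one := by simp [planeDeriv_C]
  map_x_var j h2 hj := by omega
  transcendental j hj := by
    split_ifs
    · refine transcendental_iff.2 fun q hq ↦ ?_
      rwa [aeval_X_left_eq_map, algebraMap_eq, Polynomial.map_eq_zero_iff C_injective] at hq
    · refine transcendental_iff.2 fun q hq ↦ ?_
      rwa [aeval_C_X, C_eq_zero] at hq
  simple := planeDeriv_simple hm hg hg0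
  eq_const_of_map_eq_aeval_last b h hb := by
    refine eq_const_of_planeDeriv_eq_C hm hg (h := h) (hb.trans ?_)
    simpa using aeval_C_X h
  natDegree_eq_zero_of_map_eq_add j b u h h2 hj := by omega
  eq_const_of_natDegree_lt j b u h2 hj := by omega
  eq_of_commute f h hf0 hf hh := by
    simpa using eq_of_planeDeriv_commute hm hg hg0 hf0 hf hh

end PlaneSimplicity

section Isomorphism

open Polynomial

universe u

/-- The polynomial ring in `n ≥ 2` variables carries a tower stage. -/
theorem exists_isTowerStage_equiv {k : Type u} [Field k] [CharZero k] {m : ℕ} (hm : 2 ≤ m)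
    {g : k[X]} (hg : g.natDegree ≤ m) (hg0 : g.coeff 0 ≠ 0) (G : ℕ → k[X]) (n : ℕ) (hn : 2 ≤ n)
    (hG : ∀ j, 2 ≤ j → j < n → 0 < (G j).natDegree) :
    ∃ (A : Type u) (_ : CommRing A) (_ : IsDomain A) (_ : Algebra k A) (d : Derivation k A A)
      (x : ℕ → A) (e : MvPolynomial (Fin n) k ≃ₐ[k] A),
      IsTowerStage m g G n d x ∧ ∀ i : Fin n, e (MvPolynomial.X i) = x i := by
  induction n, hn using Nat.le_induction with
  | base =>
    refine ⟨k[X][X], inferInstance, inferInstance, inferInstance, planeDeriv m g, _,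
      (Bivariate.equivMvPolynomial k).symm.trans Bivariate.swap,
      isTowerStage_planeDeriv hm hg hg0 G, fun i ↦ ?_⟩
    fin_cases i
    · simpa using Bivariate.swap_X
    · simpa using Bivariate.swap_Y
  | succ n hn ih =>
    obtain ⟨A, _, _, _, d, x, e, S, he⟩ := ih fun j h2 hj ↦ hG j h2 (by omega)
    refine ⟨A[X], inferInstance, inferInstance, inferInstance, _, _,
      ((MvPolynomial.renameEquiv k finSuccEquivLast).trans
        (MvPolynomial.optionEquivLeft k (Fin n))).trans (Polynomial.mapAlgEquiv e),
      S.extend hm hg hn (hG n hn (by omega)), fun i ↦ ?_⟩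
    induction i using Fin.lastCases with
    | last => simp
    | cast i => simp [he]

/-- A nontrivial translate of a nonconstant polynomial in characteristic zero is a different
polynomial. -/
theorem eq_zero_of_taylor_eq {k : Type*} [Field k] [CharZero k] {p : k[X]}
    (hp : 0 < p.natDegree) {c : k} (h : taylor c p = p) : c = 0 := by
  by_contra hc
  have heval : ∀ i : ℕ, p.eval (i * c) = (C (p.eval 0)).eval (i * c) := by
    intro i
    rw [eval_C]
    induction i with
    | zero => simp
    | succ i ih => rw [← ih, Nat.cast_succ, add_one_mul, ← taylor_eval, h]
  have hinf : Set.Infinite {a | p.eval a = (C (p.eval 0)).eval a} :=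
    Set.infinite_of_injective_forall_mem (f := fun i : ℕ ↦ (i : k) * c)
      (fun i j hij ↦ by simpa [hc] using hij) heval
  rw [eq_of_infinite_eval_eq _ _ hinf, natDegree_C] at hp
  exact hp.false

namespace IsTowerStage

variable {k A : Type*} [Field k] [CommRing A] [Algebra k A]
  {m : ℕ} {g : k[X]} {G : ℕ → k[X]} {n : ℕ} {d : Derivation k A A} {x : ℕ → A}

theorem exists_map_var_eq_add (S : IsTowerStage m g G n d x) {σ : A →ₐ[k] A}
    (hd : ∀ f, σ (d f) = d (σ f)) {j : ℕ} (h2 : 2 ≤ j) (hj : j < n)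
    (hσ : σ (x (j - 1)) = x (j - 1)) : ∃ c, σ (x j) = x j + algebraMap k A c := by
  have h : d (σ (x j) - x j) = algebraMap k A 0 := by
    rw [map_sub, ← hd, S.map_x_var j h2 hj, ← aeval_algHom_apply, hσ, sub_self, map_zero]
  obtain ⟨c, hc⟩ := S.const_of_map_eq_const h
  exact ⟨c, by rw [← hc, add_sub_cancel]⟩

/-- An endomorphism commuting with the derivation of a tower stage fixes all variables but the
last, which it translates. -/
theorem map_var_of_commute [CharZero k] [IsDomain A] (S : IsTowerStage m g G n d x)
    (hn : 2 ≤ n) (hG : ∀ j, 2 ≤ j → j < n → 0 < (G j).natDegree) (σ : A →ₐ[k] A)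
    (hσ : Function.Injective σ) (hd : ∀ f, σ (d f) = d (σ f)) (j : ℕ) (hj : j + 1 < n) :
    σ (x j) = x j := by
  have h01 : σ (x 0) = x 0 ∧ σ (x 1) = x 1 := by
    refine S.eq_of_commute _ _ ?_ ?_ ?_
    · rw [map_ne_zero_iff _ hσ]
      exact fun h ↦ S.transcendental 0 (by omega) (h ▸ isAlgebraic_zero)
    · rw [← hd, S.map_x_zero, map_add, map_mul, map_pow, aeval_algHom_apply]
    · rw [← hd, S.map_x_one, map_pow]
  induction j using Nat.strong_induction_on with
  | _ j ih =>
  rcases j with _ | _ | j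
  · exact h01.1
  · exact h01.2
  set i := j + 2 with hi
  obtain ⟨c, hc⟩ := S.exists_map_var_eq_add hd (j := i) (by omega) (by omega)
    (ih (i - 1) (by omega) (by omega))
  have hGi := hG (i + 1) (by omega) hj
  have hb : d (σ (x (i + 1)) - x (i + 1)) =
      aeval (x i) (taylor c (G (i + 1)) - G (i + 1)) := by
    rw [map_sub, ← hd, S.map_x_var (i + 1) (by omega) hj, ← aeval_algHom_apply,
      Nat.add_sub_cancel, hc, map_sub, taylor_apply, aeval_comp]
    simp
  have hlt : (taylor c (G (i + 1)) - G (i + 1)).natDegree < (G (i + 1)).natDegree := by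
    by_cases h0 : taylor c (G (i + 1)) - G (i + 1) = 0
    · rwa [h0, natDegree_zero]
    · have hG0 : G (i + 1) ≠ 0 := ne_zero_of_natDegree_gt hGi
      exact natDegree_lt_natDegree h0
        (degree_sub_lt_right (degree_taylor _ _) hG0 (leadingCoeff_taylor _ _))
  obtain ⟨c', hc'⟩ := S.eq_const_of_natDegree_lt (i + 1) _ _ (by omega) hj hlt hb
  rw [hc', Derivation.map_algebraMap] at hb
  have h0 := transcendental_iff.1 (S.transcendental i (by omega)) _ hb.symm
  rw [hc, eq_zero_of_taylor_eq hGi (sub_eq_zero.1 h0), map_zero, add_zero]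

end IsTowerStage
/-- Commuting with derivations can be checked on the variables. -/
theorem MvPolynomial.map_derivation_apply {ι k A : Type*} [CommRing k] [CommRing A] [Algebra k A]
    (e : MvPolynomial ι k →ₐ[k] A)
    (D : Derivation k (MvPolynomial ι k) (MvPolynomial ι k)) (d : Derivation k A A)
    (h : ∀ i, e (D (X i)) = d (e (X i))) (f : MvPolynomial ι k) : e (D f) = d (e f) := by
  induction f using MvPolynomial.induction_on with
  | C a => rw [← MvPolynomial.algebraMap_eq, D.map_algebraMap, map_zero, e.commutes,
      d.map_algebraMap]
  | add p q hp hq => simp only [map_add, hp, hq]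
  | mul_X p i hp => simp only [map_mul, Derivation.leibniz, smul_eq_mul, map_add, h, hp]

end Isomorphism

open MvPolynomial

/-- For `m ≥ 2` and `d₂ = (x₁^m x₂ + g(x₁))∂_{x₁} + x₁^{m-1}∂_{x₂}` with
`g ∈ k[x₁]`, `deg g ≤ m`, `gcd(x₁, g) = 1` (i.e. `x₁ ∤ g`), any extension
`d_n = d₂ + g₂(x₂)∂_{x₃} + … + g_{n-1}(x_{n-1})∂_{x_n}` with nonconstant `g_j` is simple
and its isotropy group is exactly the translations `(x₁,…,x_{n-1}, x_n + c)`. -/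
theorem stmt16 (k : Type*) [Field k] [CharZero k]
    (m : ℕ) (hm : 2 ≤ m)
    (g : Polynomial k) (hgdeg : g.natDegree ≤ m) (hgcd : ¬ Polynomial.X ∣ g)
    (n : ℕ) (hn : 2 < n)
    (d2 : Derivation k (MvPolynomial (Fin 2) k) (MvPolynomial (Fin 2) k))
    (hd2x : d2 (X 0) = X 0 ^ m * X 1 + Polynomial.aeval (X 0 : MvPolynomial (Fin 2) k) g)
    (hd2y : d2 (X 1) = X 0 ^ (m - 1))
    (G : ℕ → Polynomial k)
    (hGnc : ∀ j : ℕ, 2 ≤ j → j < n → 0 < (G j).natDegree)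
    (dn : Derivation k (MvPolynomial (Fin n) k) (MvPolynomial (Fin n) k))
    (hres : ∀ j : Fin 2,
      dn (X (Fin.castLE hn.le j)) = rename (Fin.castLE hn.le) (d2 (X j)))
    (hG : ∀ (j : ℕ) (h1 : 2 ≤ j) (h2 : j < n),
      dn (X (⟨j, h2⟩ : Fin n)) = Polynomial.aeval (X (⟨j - 1, by omega⟩ : Fin n)) (G j)) :
    (∀ I : Ideal (MvPolynomial (Fin n) k), (∀ f ∈ I, dn f ∈ I) → I = ⊥ ∨ I = ⊤) ∧
      (∀ ρ : MvPolynomial (Fin n) k ≃ₐ[k] MvPolynomial (Fin n) k,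
        (∀ f, ρ (dn f) = dn (ρ f)) ↔
          ∃ c : k, (∀ j : Fin n, (j : ℕ) + 1 < n → ρ (X j) = X j) ∧
            ρ (X (⟨n - 1, by omega⟩ : Fin n)) = X (⟨n - 1, by omega⟩ : Fin n) + C c) := by
  have hg0 : g.coeff 0 ≠ 0 := fun h ↦ hgcd (Polynomial.X_dvd_iff.2 h)
  obtain ⟨A, _, _, _, d, x, e, S, he⟩ := exists_isTowerStage_equiv hm hgdeg hg0 G n hn.le hGnc
  have hdn0 : dn (X ⟨0, by omega⟩) = X ⟨0, by omega⟩ ^ m * X ⟨1, by omega⟩ +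
      Polynomial.aeval (X (⟨0, by omega⟩ : Fin n)) g := by
    have h := hres 0
    rwa [hd2x, map_add, map_mul, map_pow, ← Polynomial.aeval_algHom_apply, rename_X,
      rename_X] at h
  have hdn1 : dn (X ⟨1, by omega⟩) = X ⟨0, by omega⟩ ^ (m - 1) := by
    have h := hres 1
    rwa [hd2y, map_pow, rename_X] at h
  have hed : ∀ f, e (dn f) = d (e f) := by
    refine map_derivation_apply (e : _ →ₐ[k] A) dn d fun i ↦ ?_
    change e _ = d (e _)
    obtain ⟨_ | _ | j, hj⟩ := i
    · rw [hdn0, he, S.map_x_zero, map_add, map_mul, map_pow, ← Polynomial.aeval_algHom_apply,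
        he, he]
    · rw [hdn1, he, S.map_x_one, map_pow, he]
    · rw [hG (j + 2) (by omega) hj, he, S.map_x_var (j + 2) (by omega) hj,
        ← Polynomial.aeval_algHom_apply, he]
  refine ⟨fun I hI ↦ ?_, fun ρ ↦ ⟨fun hρ ↦ ?_, ?_⟩⟩
  · refine (S.simple (I.comap e.symm) fun f hf ↦ ?_).imp (fun h ↦ ?_) fun h ↦ ?_
    · rw [Ideal.mem_comap] at hf ⊢
      convert hI _ hf
      rw [e.symm_apply_eq, hed, e.apply_symm_apply]
    · refine (Submodule.eq_bot_iff _).2 fun f hf ↦ ?_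
      have hef : e f ∈ I.comap e.symm := by rwa [Ideal.mem_comap, e.symm_apply_apply]
      rw [h, Ideal.mem_bot] at hef
      simpa using hef
    · rw [Ideal.eq_top_iff_one, Ideal.mem_comap, map_one] at h
      exact (Ideal.eq_top_iff_one I).2 h
  · set σ : A ≃ₐ[k] A := (e.symm.trans ρ).trans e with hσ
    have hσe : ∀ f, σ (e f) = e (ρ f) := by simp [hσ]
    have hσd : ∀ f, σ (d f) = d (σ f) := by
      intro f
      obtain ⟨f, rfl⟩ := e.surjective f
      rw [← hed, hσe, hρ, hed, hσe]
    have hfix := S.map_var_of_commute hn.le hGnc (σ : A →ₐ[k] A) σ.injective hσd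
    obtain ⟨c, hc⟩ := S.exists_map_var_eq_add (σ := (σ : A →ₐ[k] A)) hσd (j := n - 1) (by omega)
      (by omega) (hfix _ (by omega))
    refine ⟨c, fun j hj ↦ e.injective ?_, e.injective ?_⟩
    · rw [← hσe, he]
      exact hfix j hj
    · rw [← hσe, map_add, he, ← algebraMap_eq, e.commutes]
      exact hc
  · rintro ⟨c, hfix, hlast⟩
    have hρd : ∀ i, ρ (dn (X i)) = dn (X i) := by
      rintro ⟨_ | _ | j, hj⟩
      · rw [hdn0, map_add, map_mul, map_pow, ← Polynomial.aeval_algHom_apply,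
          hfix _ (by simp; omega), hfix _ (by simp; omega)]
      · rw [hdn1, map_pow, hfix _ (by simp; omega)]
      · rw [hG (j + 2) (by omega) hj, ← Polynomial.aeval_algHom_apply, hfix _ (by simp; omega)]
    refine map_derivation_apply (ρ : _ →ₐ[k] _) dn dn fun i ↦ (hρd i).trans ?_
    change dn (X i) = dn (ρ (X i))
    rcases Nat.lt_or_ge (i + 1) n with hi | hi
    · rw [hfix i hi]
    · have hlasti : i = ⟨n - 1, by omega⟩ := Fin.ext (by simp; omega)
      rw [hlasti, hlast, map_add, ← algebraMap_eq, dn.map_algebraMap, add_zero]
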